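/- Let K ⊆ ℝⁿ be a compact set with nonempty interior, equipped with the Lebesgue measure (weight w ≡ 1), and let f be an n-variate real polynomial. Assume f has a global minimizer a on K with a ∈ int(K). Then there exists a constant c > 0 (depending only on K and f) such that for every integer r ≥ 1 one has E^{(r)}_K(f) ≤ c / r^2. -/

import Mathlib

open MeasureTheory

noncomputable section

/-- A polynomial is a sum of squares. -/
def IsSOS {n : ℕ} (q : MvPolynomial (Fin n) ℝ) : Prop :=
  ∃ (m : ℕ) (p : Fin m → MvPolynomial (Fin n) ℝ), q = ∑ i, p i ^ 2

/-- The Lasserre measure-based upper bound `f^{(r)}_{K,w}`: the infimum of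
`∫_K f q w dx` over sum-of-squares polynomials `q` of degree at most `2r`
with `∫_K q w dx = 1`. -/
noncomputable def lasserre {n : ℕ} (r : ℕ) (K : Set (EuclideanSpace ℝ (Fin n)))
    (w f : EuclideanSpace ℝ (Fin n) → ℝ) : ℝ :=
  sInf { v : ℝ | ∃ q : MvPolynomial (Fin n) ℝ, IsSOS q ∧ q.totalDegree ≤ 2 * r ∧
    (∫ x in K, MvPolynomial.eval (fun i => x i) q * w x) = 1 ∧
    v = ∫ x in K, f x * MvPolynomial.eval (fun i => x i) q * w x }

/-- The error `E^{(r)}_{K,w}(f) = f^{(r)}_{K,w} - min_{x ∈ K} f(x)`. -/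
noncomputable def lasserreError {n : ℕ} (r : ℕ) (K : Set (EuclideanSpace ℝ (Fin n)))
    (w f : EuclideanSpace ℝ (Fin n) → ℝ) : ℝ :=
  lasserre r K w f - sInf (f '' K)

/-- The Chebyshev-type polynomial `sin ((2m+1)θ) / sin θ`, written in the variable `sin² θ`. -/
theorem exists_polynomial_eval_sin_sq_mul_sin (m : ℕ) :
    ∃ P : Polynomial ℝ, P.natDegree ≤ m ∧ P.eval 0 = 2 * m + 1 ∧
      ∀ θ : ℝ, P.eval (Real.sin θ ^ 2) * Real.sin θ = Real.sin ((2 * m + 1) * θ) := by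
  open Polynomial in
  induction m using Nat.twoStepInduction with
  | zero => exact ⟨1, by simp⟩
  | one =>
    refine ⟨C 3 - C 4 * X, by compute_degree, by norm_num, fun θ => ?_⟩
    have h := Real.sin_three_mul θ
    norm_num
    rw [h]
    ring
  | more m ih₀ ih₁ =>
    obtain ⟨P, hPd, hP0, hP⟩ := ih₀
    obtain ⟨Q, hQd, hQ0, hQ⟩ := ih₁
    refine ⟨C 2 * (1 - C 2 * X) * Q - P, ?_, ?_, fun θ => ?_⟩
    · refine (natDegree_sub_le_of_le (m := m + 2) (n := m + 2) ?_ (by lia)).trans (by simp)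
      refine natDegree_mul_le.trans ?_
      have : (C (2 : ℝ) * (1 - C 2 * X)).natDegree ≤ 1 := by compute_degree
      lia
    · simp [hP0, hQ0]
      ring
    · have e₁ : (2 * ((m + 2 : ℕ) : ℝ) + 1) * θ = (2 * ((m + 1 : ℕ) : ℝ) + 1) * θ + 2 * θ := by
        push_cast; ring
      have e₂ : (2 * (m : ℝ) + 1) * θ = (2 * ((m + 1 : ℕ) : ℝ) + 1) * θ - 2 * θ := by
        push_cast; ring
      have hPθ := hP θ
      have hQθ := hQ θ
      rw [e₂, Real.sin_sub] at hPθ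
      rw [e₁, Real.sin_add]
      have hc : Real.cos (2 * θ) = 1 - 2 * Real.sin θ ^ 2 := by
        rw [Real.cos_two_mul, Real.cos_sq']; ring
      simp only [eval_sub, eval_mul, eval_C, eval_one, eval_X]
      rw [hc] at hPθ ⊢
      linear_combination 2 * (1 - 2 * Real.sin θ ^ 2) * hQθ - hPθ

theorem abs_sin_nat_mul_le (k : ℕ) (θ : ℝ) : |Real.sin (k * θ)| ≤ k * |Real.sin θ| := by
  induction k with
  | zero => simp
  | succ k ih =>
    have e : ((k + 1 : ℕ) : ℝ) * θ = k * θ + θ := by push_cast; ring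
    rw [e, Real.sin_add]
    calc |Real.sin (k * θ) * Real.cos θ + Real.cos (k * θ) * Real.sin θ|
        ≤ |Real.sin (k * θ)| * |Real.cos θ| + |Real.cos (k * θ)| * |Real.sin θ| := by
          rw [← abs_mul, ← abs_mul]; exact abs_add_le _ _
      _ ≤ |Real.sin (k * θ)| * 1 + 1 * |Real.sin θ| := by
          gcongr <;> exact Real.abs_cos_le_one _
      _ ≤ ((k + 1 : ℕ) : ℝ) * |Real.sin θ| := by push_cast; linarith

/-- A polynomial of degree `m` whose composition with `t ↦ t²` is concentrated on `[0, 1]`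
at scale `1 / (2m+1)` around the origin. -/
theorem exists_polynomial_peak (m : ℕ) :
    ∃ P : Polynomial ℝ, P.natDegree ≤ m ∧
      (∀ t : ℝ, 0 ≤ t → t ≤ 1 → |P.eval (t ^ 2)| * (1 + (2 * m + 1) * t) ≤ 2) ∧
      ∀ t : ℝ, 0 ≤ t → (2 * m + 1) * t ≤ 1 → 1 / 2 ≤ P.eval (t ^ 2) := by
  obtain ⟨P, hPd, hP0, hP⟩ := exists_polynomial_eval_sin_sq_mul_sin m
  set N : ℝ := 2 * m + 1 with hN
  have hN1 : 1 ≤ N := by rw [hN]; linarith [m.cast_nonneg (α := ℝ)]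
  have hN0 : 0 < N := by linarith
  refine ⟨Polynomial.C N⁻¹ * P, (Polynomial.natDegree_C_mul_le _ _).trans hPd, ?_, ?_⟩
  · intro t ht0 ht1
    rcases ht0.eq_or_lt with rfl | ht
    · simp [hP0, hN0.ne']
    have hs := Real.sin_arcsin (by linarith) ht1
    have h := hP (Real.arcsin t)
    rw [hs] at h
    have h₁ : |P.eval (t ^ 2)| * t ≤ 1 := by
      rw [← abs_of_pos ht, ← abs_mul, abs_of_pos ht, h]
      exact Real.abs_sin_le_one _
    have h₂ : |P.eval (t ^ 2)| ≤ N := by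
      refine le_of_mul_le_mul_right ?_ ht
      nth_rw 2 [← abs_of_pos ht]
      rw [← abs_mul, h]
      have := abs_sin_nat_mul_le (2 * m + 1) (Real.arcsin t)
      rw [hs, abs_of_pos ht] at this
      simpa [hN] using this
    rw [Polynomial.eval_mul, Polynomial.eval_C, abs_mul, abs_of_pos (inv_pos.2 hN0)]
    have e : N⁻¹ * |P.eval (t ^ 2)| * (1 + N * t)
        = N⁻¹ * |P.eval (t ^ 2)| + |P.eval (t ^ 2)| * t := by field_simp
    have h₃ : N⁻¹ * |P.eval (t ^ 2)| ≤ 1 := by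
      rw [inv_mul_le_iff₀ hN0]; linarith
    linarith
  · intro t ht0 ht
    rcases ht0.eq_or_lt with rfl | htp
    · simp [hP0, hN0.ne']; norm_num
    have ht1 : t ≤ 1 := by nlinarith
    have hs := Real.sin_arcsin (by linarith) ht1
    have h := hP (Real.arcsin t)
    rw [hs] at h
    have hα : 0 ≤ Real.arcsin t := Real.arcsin_nonneg.2 ht0
    have hαt : 2 / Real.pi * Real.arcsin t ≤ t := by
      have := Real.mul_le_sin hα (Real.arcsin_le_pi_div_two t)
      rwa [hs] at this
    have htα : t ≤ Real.arcsin t := by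
      have := Real.sin_le hα
      rwa [hs] at this
    have hNα : N * Real.arcsin t ≤ Real.pi / 2 := by
      have hpi := Real.pi_pos
      have : Real.arcsin t ≤ Real.pi / 2 * t := by
        rw [div_mul_eq_mul_div, div_le_iff₀ hpi] at hαt
        linarith
      nlinarith
    have h₁ := Real.mul_le_sin (by positivity) hNα
    rw [← h] at h₁
    rw [Polynomial.eval_mul, Polynomial.eval_C]
    have h₂ : 2 / Real.pi * N ≤ P.eval (t ^ 2) := by
      refine le_of_mul_le_mul_right (le_trans ?_ h₁) htp
      rw [mul_assoc]
      gcongr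
    have h₃ : (1 : ℝ) / 2 ≤ 2 / Real.pi := by
      rw [div_le_div_iff₀ two_pos Real.pi_pos]
      linarith [Real.pi_le_four]
    rw [inv_mul_eq_div, le_div_iff₀ hN0]
    nlinarith

theorem totalDegree_polynomial_aeval_le {σ R : Type*} [CommSemiring R]
    (P : Polynomial R) (S : MvPolynomial σ R) :
    (Polynomial.aeval S P).totalDegree ≤ P.natDegree * S.totalDegree := by
  rw [Polynomial.aeval_eq_sum_range]
  refine MvPolynomial.totalDegree_finsetSum_le fun i hi => ?_
  refine (MvPolynomial.totalDegree_smul_le _ _).trans ((MvPolynomial.totalDegree_pow _ _).trans ?_)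
  exact Nat.mul_le_mul_right _ (Finset.mem_range_succ_iff.1 hi)

/-- The even powers of a univariate polynomial in the (rescaled) squared distance to a point
are sums of squares. -/
theorem exists_isSOS_eval_eq {n : ℕ} (P : Polynomial ℝ) (a : EuclideanSpace ℝ (Fin n)) (L : ℝ)
    (k : ℕ) :
    ∃ q : MvPolynomial (Fin n) ℝ, IsSOS q ∧ q.totalDegree ≤ 2 * (2 * k * P.natDegree) ∧
      ∀ x : EuclideanSpace ℝ (Fin n),
        MvPolynomial.eval (fun i => x i) q = P.eval ((‖x - a‖ / L) ^ 2) ^ (2 * k) := by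
  let S : MvPolynomial (Fin n) ℝ :=
    (L⁻¹ ^ 2) • ∑ i, (MvPolynomial.X i - MvPolynomial.C (a i)) ^ 2
  have hS : S.totalDegree ≤ 2 := by
    refine (MvPolynomial.totalDegree_smul_le _ _).trans
      (MvPolynomial.totalDegree_finsetSum_le fun i _ => ?_)
    refine (MvPolynomial.totalDegree_pow _ _).trans ?_
    have : (MvPolynomial.X i - MvPolynomial.C (a i) : MvPolynomial (Fin n) ℝ).totalDegree ≤ 1 :=
      (MvPolynomial.totalDegree_sub _ _).trans (by simp)
    exact Nat.mul_le_mul_left 2 this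
  have hSe (x : EuclideanSpace ℝ (Fin n)) :
      MvPolynomial.eval (fun i => x i) S = (‖x - a‖ / L) ^ 2 := by
    simp only [S, MvPolynomial.smul_eval, map_sum, map_pow, map_sub, MvPolynomial.eval_X,
      MvPolynomial.eval_C]
    rw [div_pow, EuclideanSpace.real_norm_sq_eq, div_eq_inv_mul, inv_pow]
    simp
  refine ⟨(Polynomial.aeval S P ^ k) ^ 2, ⟨1, fun _ => Polynomial.aeval S P ^ k, by simp⟩, ?_, ?_⟩
  · refine (MvPolynomial.totalDegree_pow _ _).trans (Nat.mul_le_mul_left _ ?_)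
    refine (MvPolynomial.totalDegree_pow _ _).trans ?_
    have h₁ := totalDegree_polynomial_aeval_le P S
    have h₂ : P.natDegree * S.totalDegree ≤ P.natDegree * 2 := Nat.mul_le_mul_left _ hS
    calc k * _ ≤ k * (P.natDegree * 2) := Nat.mul_le_mul_left _ (h₁.trans h₂)
      _ = _ := by ring
  · intro x
    have : MvPolynomial.eval (fun i => x i) (Polynomial.aeval S P)
        = P.eval ((‖x - a‖ / L) ^ 2) := by
      rw [← hSe x, ← MvPolynomial.coe_aeval_eq_eval, RingHom.coe_coe,
        ← Polynomial.aeval_algHom_apply, Polynomial.coe_aeval_eq_eval]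
    rw [map_pow, map_pow, this, ← pow_mul, mul_comm]

theorem IsSOS.eval_nonneg {n : ℕ} {q : MvPolynomial (Fin n) ℝ} (hq : IsSOS q) (x : Fin n → ℝ) :
    0 ≤ MvPolynomial.eval x q := by
  obtain ⟨m, p, rfl⟩ := hq
  rw [map_sum]
  exact Finset.sum_nonneg fun i _ => by rw [map_pow]; positivity

theorem IsSOS.smul {n : ℕ} {q : MvPolynomial (Fin n) ℝ} (hq : IsSOS q) {c : ℝ} (hc : 0 ≤ c) :
    IsSOS (c • q) := by
  obtain ⟨m, p, rfl⟩ := hq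
  refine ⟨m, fun i => √c • p i, ?_⟩
  simp [smul_pow, Real.sq_sqrt hc, Finset.smul_sum]

/-- A `C²` function grows at most quadratically on a compact set around a local minimizer. -/
theorem exists_sub_le_mul_norm_sq {E : Type*} [NormedAddCommGroup E] [NormedSpace ℝ E]
    {F : E → ℝ} (hF : ContDiff ℝ 2 F) {K : Set E} (hK : IsCompact K) {a : E}
    (ha : IsLocalMin F a) :
    ∃ M : ℝ, 0 < M ∧ ∀ x ∈ K, F x - F a ≤ M * ‖x - a‖ ^ 2 := by
  have h0 : fderiv ℝ F a = 0 := ha.fderiv_eq_zero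
  have hd : ContDiffAt ℝ 1 (fderiv ℝ F) a := hF.contDiffAt.fderiv_right (by norm_num)
  obtain ⟨C, t, ht, hC⟩ := hd.exists_lipschitzOnWith
  obtain ⟨δ, hδ, hδt⟩ := Metric.mem_nhds_iff.1 ht
  obtain ⟨B, hB⟩ := (hK.image hF.continuous).bddAbove
  have hnear : ∀ x ∈ Metric.ball a δ, F x - F a ≤ C * ‖x - a‖ ^ 2 := by
    intro x hx
    have hsub : Metric.closedBall a ‖x - a‖ ⊆ t := by
      refine (Metric.closedBall_subset_ball ?_).trans hδt
      rwa [← dist_eq_norm]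
    have := (convex_closedBall a ‖x - a‖).norm_image_sub_le_of_norm_fderiv_le
      (𝕜 := ℝ) (f := F) (C := C * ‖x - a‖) (x := a) (y := x)
      (fun y _ => (hF.differentiable (by norm_num)).differentiableAt) (fun y hy => ?_)
      (Metric.mem_closedBall_self (norm_nonneg _)) (by simp [dist_eq_norm])
    · rw [Real.norm_eq_abs] at this
      calc F x - F a ≤ |F x - F a| := le_abs_self _
        _ ≤ _ := this
        _ = _ := by ring
    · have h := hC.dist_le_mul y (hsub hy) a (mem_of_mem_nhds ht)
      rw [h0, dist_zero_right] at h
      exact h.trans (mul_le_mul_of_nonneg_left hy C.2)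
  refine ⟨max (C : ℝ) (max ((B - F a) / δ ^ 2) 1), by positivity, fun x hx => ?_⟩
  by_cases hxδ : x ∈ Metric.ball a δ
  · exact (hnear x hxδ).trans (by gcongr; exact le_max_left _ _)
  · have hδx : δ ≤ ‖x - a‖ := by simpa [dist_eq_norm] using hxδ
    calc F x - F a ≤ B - F a := by gcongr; exact hB ⟨x, hx, rfl⟩
      _ = (B - F a) / δ ^ 2 * δ ^ 2 := by field_simp
      _ ≤ max (C : ℝ) (max ((B - F a) / δ ^ 2) 1) * δ ^ 2 := by
        gcongr; exact (le_max_left _ _).trans (le_max_right _ _)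
      _ ≤ _ := by gcongr

theorem continuous_eval_ofLp {n : ℕ} (q : MvPolynomial (Fin n) ℝ) :
    Continuous fun x : EuclideanSpace ℝ (Fin n) => MvPolynomial.eval (fun i => x i) q :=
  (MvPolynomial.continuous_eval q).comp (by fun_prop)

theorem contDiff_eval_ofLp {n : ℕ} (q : MvPolynomial (Fin n) ℝ) :
    ContDiff ℝ 2 fun x : EuclideanSpace ℝ (Fin n) => MvPolynomial.eval (fun i => x i) q := by
  have h : ContDiff ℝ 2 fun y : Fin n → ℝ => MvPolynomial.eval y q := by
    rw [← contDiffOn_univ]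
    exact (AnalyticOnNhd.eval_mvPolynomial q).contDiffOn uniqueDiffOn_univ
  exact h.comp (by fun_prop)

/-- Any sum of squares with positive mass certifies an upper bound on the Lasserre error. -/
theorem lasserreError_le_of_isSOS {n : ℕ} {K : Set (EuclideanSpace ℝ (Fin n))} (hK : IsCompact K)
    {F : EuclideanSpace ℝ (Fin n) → ℝ} (hF : Continuous F) {a : EuclideanSpace ℝ (Fin n)}
    (haK : a ∈ K) (hmin : ∀ x ∈ K, F a ≤ F x) {r : ℕ} {q : MvPolynomial (Fin n) ℝ}
    (hq : IsSOS q) (hdeg : q.totalDegree ≤ 2 * r)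
    (hpos : 0 < ∫ x in K, MvPolynomial.eval (fun i => x i) q) {ε : ℝ}
    (hε : ∫ x in K, (F x - F a) * MvPolynomial.eval (fun i => x i) q
      ≤ ε * ∫ x in K, MvPolynomial.eval (fun i => x i) q) :
    lasserreError r K (fun _ => 1) F ≤ ε := by
  have hint (p : MvPolynomial (Fin n) ℝ) :
      IntegrableOn (fun x : EuclideanSpace ℝ (Fin n) => MvPolynomial.eval (fun i => x i) p) K :=
    (continuous_eval_ofLp p).continuousOn.integrableOn_compact hK
  have hintF (p : MvPolynomial (Fin n) ℝ) :
      IntegrableOn (fun x : EuclideanSpace ℝ (Fin n) =>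
        F x * MvPolynomial.eval (fun i => x i) p) K :=
    (hF.mul (continuous_eval_ofLp p)).continuousOn.integrableOn_compact hK
  have hsub (p : MvPolynomial (Fin n) ℝ) :
      ∫ x in K, (F x - F a) * MvPolynomial.eval (fun i => x i) p
        = (∫ x in K, F x * MvPolynomial.eval (fun i => x i) p)
          - F a * ∫ x in K, MvPolynomial.eval (fun i => x i) p := by
    simp_rw [sub_mul]
    rw [integral_sub (hintF p) ((hint p).const_mul _), integral_const_mul]
  have hleast : sInf (F '' K) = F a :=
    IsLeast.csInf_eq ⟨⟨a, haK, rfl⟩, by rintro _ ⟨x, hx, rfl⟩; exact hmin x hx⟩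
  set I : ℝ := ∫ x in K, MvPolynomial.eval (fun i => x i) q with hI
  have hbdd : BddBelow { v : ℝ | ∃ q : MvPolynomial (Fin n) ℝ, IsSOS q ∧ q.totalDegree ≤ 2 * r ∧
      (∫ x in K, MvPolynomial.eval (fun i => x i) q * (fun _ => (1 : ℝ)) x) = 1 ∧
      v = ∫ x in K, F x * MvPolynomial.eval (fun i => x i) q * (fun _ => (1 : ℝ)) x } := by
    refine ⟨F a, ?_⟩
    rintro v ⟨p, hp, -, hp1, rfl⟩
    simp only [mul_one] at hp1 ⊢
    have h := hsub p
    have h0 : 0 ≤ ∫ x in K, (F x - F a) * MvPolynomial.eval (fun i => x i) p :=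
      setIntegral_nonneg hK.measurableSet fun x hx =>
        mul_nonneg (sub_nonneg.2 (hmin x hx)) (hp.eval_nonneg _)
    rw [hp1] at h
    linarith
  rw [lasserreError, lasserre, hleast]
  have hmem := csInf_le hbdd ⟨I⁻¹ • q, hq.smul (inv_nonneg.2 hpos.le),
    (MvPolynomial.totalDegree_smul_le _ _).trans hdeg, ?_, rfl⟩
  · refine (sub_le_sub_right hmem _).trans ?_
    simp only [MvPolynomial.smul_eval, mul_one, mul_left_comm _ I⁻¹]
    rw [integral_const_mul]
    rw [hsub] at hε
    rw [sub_le_iff_le_add, inv_mul_le_iff₀ hpos]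
    linarith
  · simp only [MvPolynomial.smul_eval, mul_one]
    rw [integral_const_mul, ← hI, inv_mul_cancel₀ hpos.ne']

/-- The second moment of a function decaying at scale `1 / s` around `a`. -/
theorem setIntegral_norm_sq_mul_le {n : ℕ} {K : Set (EuclideanSpace ℝ (Fin n))}
    (hK : IsCompact K) (a : EuclideanSpace ℝ (Fin n)) {h : EuclideanSpace ℝ (Fin n) → ℝ}
    (hc : Continuous h) {s : ℝ} (hs : 0 < s)
    (hle : ∀ x ∈ K, |h x| * (1 + s * ‖x - a‖) ≤ 2) :
    ∫ x in K, ‖x - a‖ ^ 2 * h x ^ (2 * (n + 2)) ≤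
      4 ^ (n + 2) * (∫ y : EuclideanSpace ℝ (Fin n), (1 + ‖y‖) ^ (-(2 * n + 2 : ℝ)))
        / s ^ (n + 2) := by
  set g : EuclideanSpace ℝ (Fin n) → ℝ := fun y => (1 + ‖y‖) ^ (-(2 * n + 2 : ℝ)) with hg
  have hgi : Integrable g := by
    refine integrable_one_add_norm ?_
    rw [finrank_euclideanSpace_fin]
    linarith [n.cast_nonneg (α := ℝ)]
  have hg' (y : EuclideanSpace ℝ (Fin n)) : g y = ((1 + ‖y‖) ^ (2 * n + 2))⁻¹ := by
    rw [hg]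
    dsimp only
    rw [Real.rpow_neg (by positivity), ← Real.rpow_natCast]
    push_cast
    rfl
  have hgs : Integrable fun x => g (s • (x - a)) :=
    (hgi.comp_smul hs.ne').comp_sub_right a
  have hval : ∫ x, g (s • (x - a)) = (s ^ n)⁻¹ * ∫ y, g y := by
    rw [integral_sub_right_eq_self (fun x => g (s • x)) a, Measure.integral_comp_smul,
      finrank_euclideanSpace_fin, abs_of_pos (by positivity), smul_eq_mul]
  have hpt : ∀ x ∈ K, ‖x - a‖ ^ 2 * h x ^ (2 * (n + 2))
      ≤ 4 ^ (n + 2) / s ^ 2 * g (s • (x - a)) := by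
    intro x hx
    have hu : ‖s • (x - a)‖ = s * ‖x - a‖ := by rw [norm_smul, Real.norm_of_nonneg hs.le]
    rw [hg', hu]
    have hx' := hle x hx
    set u := ‖x - a‖ with hu'
    have hu0 : 0 ≤ u := norm_nonneg _
    have h₁ : (|h x| * (1 + s * u)) ^ (2 * (n + 2)) ≤ 2 ^ (2 * (n + 2)) := by gcongr
    rw [mul_pow, Even.pow_abs (even_two_mul _), pow_mul 2 2] at h₁
    have h₂ : (s * u) ^ 2 ≤ (1 + s * u) ^ 2 := by gcongr; linarith
    rw [← div_eq_mul_inv, div_div, le_div_iff₀ (by positivity)]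
    calc u ^ 2 * h x ^ (2 * (n + 2)) * (s ^ 2 * (1 + s * u) ^ (2 * n + 2))
        = (s * u) ^ 2 * (h x ^ (2 * (n + 2)) * (1 + s * u) ^ (2 * n + 2)) := by ring
      _ ≤ (1 + s * u) ^ 2 * (h x ^ (2 * (n + 2)) * (1 + s * u) ^ (2 * n + 2)) := by
        gcongr
        exact mul_nonneg (Even.pow_nonneg (even_two_mul _) _) (by positivity)
      _ = h x ^ (2 * (n + 2)) * (1 + s * u) ^ (2 * (n + 2)) := by ring
      _ ≤ 4 ^ (n + 2) := by norm_num at h₁ ⊢; exact h₁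
  calc ∫ x in K, ‖x - a‖ ^ 2 * h x ^ (2 * (n + 2))
      ≤ ∫ x in K, 4 ^ (n + 2) / s ^ 2 * g (s • (x - a)) := by
        refine setIntegral_mono_on ?_ (hgs.const_mul _).integrableOn hK.measurableSet hpt
        exact Continuous.continuousOn (by fun_prop) |>.integrableOn_compact hK
    _ ≤ ∫ x, 4 ^ (n + 2) / s ^ 2 * g (s • (x - a)) := by
        refine setIntegral_le_integral (hgs.const_mul _) (.of_forall fun x => ?_)
        simp only [Pi.zero_apply, hg']
        positivity
    _ = _ := by
        rw [integral_const_mul, hval]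
        field_simp
        ring

/-- A lower bound on the mass of a function that is at least `1 / 2` on a small ball. -/
theorem le_setIntegral_pow {n : ℕ} {K : Set (EuclideanSpace ℝ (Fin n))}
    (hK : IsCompact K) {a : EuclideanSpace ℝ (Fin n)} {h : EuclideanSpace ℝ (Fin n) → ℝ}
    (hc : Continuous h) {ρ N : ℝ} (hρ : 0 < ρ) (hN : 0 < N) (hsub : Metric.ball a (ρ / N) ⊆ K)
    (hle : ∀ x ∈ Metric.ball a (ρ / N), 1 / 2 ≤ h x) (k : ℕ) :
    (1 / 2) ^ (2 * k) * volume.real (Metric.ball (0 : EuclideanSpace ℝ (Fin n)) 1) * ρ ^ n / N ^ n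
      ≤ ∫ x in K, h x ^ (2 * k) := by
  have hint : IntegrableOn (fun x => h x ^ (2 * k)) K :=
    (hc.pow _).continuousOn.integrableOn_compact hK
  have hvol : volume.real (Metric.ball a (ρ / N))
      = (ρ / N) ^ n * volume.real (Metric.ball (0 : EuclideanSpace ℝ (Fin n)) 1) := by
    rw [Measure.real, Measure.addHaar_ball_of_pos _ _ (by positivity), ENNReal.toReal_mul,
      ENNReal.toReal_ofReal (by positivity), finrank_euclideanSpace_fin, Measure.real]
  calc _ = ∫ x in Metric.ball a (ρ / N), ((1 : ℝ) / 2) ^ (2 * k) := by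
        rw [setIntegral_const, hvol, smul_eq_mul, div_pow ρ]
        ring
    _ ≤ ∫ x in Metric.ball a (ρ / N), h x ^ (2 * k) := by
        refine setIntegral_mono_on (integrableOn_const measure_ball_lt_top.ne)
          (hint.mono_set hsub) measurableSet_ball fun x hx => ?_
        gcongr
        exact hle x hx
    _ ≤ _ := setIntegral_mono_set hint
        (.of_forall fun x => Even.pow_nonneg (even_two_mul _) _) hsub.eventuallyLE

/-- Theorem: for a compact `K ⊆ ℝⁿ` with nonempty interior, equipped with the Lebesgue
measure, if a polynomial `f` has a global minimizer `a` on `K` lying in the interior of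
`K`, then the Lasserre error is `O(1/r²)`. -/
theorem stmt3 {n : ℕ}
    (K : Set (EuclideanSpace ℝ (Fin n)))
    (hKc : IsCompact K) (hKi : (interior K).Nonempty)
    (f : MvPolynomial (Fin n) ℝ)
    (F : EuclideanSpace ℝ (Fin n) → ℝ)
    (hF : ∀ x : EuclideanSpace ℝ (Fin n), F x = MvPolynomial.eval (fun i => x i) f)
    (a : EuclideanSpace ℝ (Fin n)) (ha : a ∈ interior K)
    (hmin : ∀ x ∈ K, F a ≤ F x) :
    ∃ c : ℝ, 0 < c ∧ ∀ r : ℕ, 1 ≤ r →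
      lasserreError r K (fun _ => 1) F ≤ c / (r : ℝ) ^ 2 := by
  obtain ⟨ρ, hρ, hρK⟩ := Metric.mem_nhds_iff.1 (mem_interior_iff_mem_nhds.1 ha)
  have haK : a ∈ K := interior_subset ha
  obtain rfl : F = fun x => MvPolynomial.eval (fun i => x i) f := funext hF
  have hloc : IsLocalMin (fun x : EuclideanSpace ℝ (Fin n) =>
      MvPolynomial.eval (fun i => x i) f) a :=
    Filter.mem_of_superset (mem_interior_iff_mem_nhds.1 ha) hmin
  obtain ⟨M, hM, hquad⟩ := exists_sub_le_mul_norm_sq (contDiff_eval_ofLp f) hKc hloc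
  obtain ⟨L, hρL, hL⟩ := hKc.isBounded.subset_closedBall_lt ρ a
  have hL0 : 0 < L := hρ.trans hρL
  set A : ℝ := 4 ^ (n + 2) * ∫ y : EuclideanSpace ℝ (Fin n), (1 + ‖y‖) ^ (-(2 * n + 2 : ℝ)) with hA
  have hA0 : 0 ≤ A := mul_nonneg (by positivity) (integral_nonneg fun y => by positivity)
  set B : ℝ := (1 / 2) ^ (2 * (n + 2)) *
    volume.real (Metric.ball (0 : EuclideanSpace ℝ (Fin n)) 1) * ρ ^ n with hB
  have hB0 : 0 < B := by
    have : 0 < volume.real (Metric.ball (0 : EuclideanSpace ℝ (Fin n)) 1) :=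
      ENNReal.toReal_pos (Metric.measure_ball_pos _ _ one_pos).ne' measure_ball_lt_top.ne
    positivity
  refine ⟨M * A * L ^ (n + 2) / B * (2 * (n + 2)) ^ 2 + 1, by positivity, fun r hr => ?_⟩
  set m : ℕ := r / (2 * (n + 2)) with hm
  obtain ⟨P, hPd, hPu, hPl⟩ := exists_polynomial_peak m
  set N : ℝ := 2 * m + 1 with hN
  have hN1 : 1 ≤ N := by rw [hN]; linarith [m.cast_nonneg (α := ℝ)]
  have hN0 : 0 < N := by linarith
  have hrN : (r : ℝ) ≤ 2 * (n + 2) * N := by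
    have h₁ : r ≤ 2 * (n + 2) * (m + 1) := (Nat.lt_mul_div_succ r (by lia)).le
    have h₂ : (r : ℝ) ≤ 2 * (n + 2) * (m + 1) := by exact_mod_cast h₁
    refine h₂.trans ?_
    gcongr
    rw [hN]; linarith [m.cast_nonneg (α := ℝ)]
  obtain ⟨q, hq, hqd, hqe⟩ := exists_isSOS_eval_eq P a L (n + 2)
  have hdeg : q.totalDegree ≤ 2 * r := by
    refine hqd.trans (Nat.mul_le_mul_left _ ?_)
    exact (Nat.mul_le_mul_left _ hPd).trans (Nat.mul_div_le _ _)
  set h : EuclideanSpace ℝ (Fin n) → ℝ := fun x => P.eval ((‖x - a‖ / L) ^ 2) with hh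
  have hc : Continuous h := P.continuous.comp (by fun_prop)
  have hlow : B / N ^ n ≤ ∫ x in K, h x ^ (2 * (n + 2)) := by
    have hsub : Metric.ball a (ρ / N) ⊆ Metric.ball a ρ :=
      Metric.ball_subset_ball (div_le_self hρ.le hN1)
    refine le_setIntegral_pow hKc hc hρ hN0 (hsub.trans hρK) (fun x hx => ?_) _
    refine hPl _ (by positivity) ?_
    rw [Metric.mem_ball, dist_eq_norm, lt_div_iff₀ hN0] at hx
    rw [← mul_div_assoc, div_le_one hL0]
    linarith
  have hup : ∫ x in K, ‖x - a‖ ^ 2 * h x ^ (2 * (n + 2)) ≤ A / (N / L) ^ (n + 2) := by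
    refine setIntegral_norm_sq_mul_le hKc a hc (by positivity) fun x hx => ?_
    have hxL : ‖x - a‖ ≤ L := by simpa [dist_eq_norm] using hL hx
    have := hPu (‖x - a‖ / L) (by positivity) ((div_le_one hL0).2 hxL)
    rwa [← mul_div_assoc, ← div_mul_eq_mul_div] at this
  have hpos : 0 < ∫ x in K, h x ^ (2 * (n + 2)) := lt_of_lt_of_le (by positivity) hlow
  refine lasserreError_le_of_isSOS hKc (continuous_eval_ofLp f) haK hmin hq hdeg
    (by simpa only [hqe] using hpos) ?_
  simp only [hqe]
  calc ∫ x in K, (MvPolynomial.eval (fun i => x i) f - MvPolynomial.eval (fun i => a i) f)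
          * h x ^ (2 * (n + 2))
      ≤ ∫ x in K, M * (‖x - a‖ ^ 2 * h x ^ (2 * (n + 2))) := by
        refine setIntegral_mono_on ?_ ?_ hKc.measurableSet fun x hx => ?_
        · exact (((continuous_eval_ofLp f).sub continuous_const).mul
            (hc.pow _)).continuousOn.integrableOn_compact hKc
        · exact Continuous.continuousOn (by fun_prop) |>.integrableOn_compact hKc
        · rw [← mul_assoc]
          exact mul_le_mul_of_nonneg_right (hquad x hx) (Even.pow_nonneg (even_two_mul _) _)
    _ = M * ∫ x in K, ‖x - a‖ ^ 2 * h x ^ (2 * (n + 2)) := integral_const_mul _ _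
    _ ≤ M * (A / (N / L) ^ (n + 2)) := by gcongr
    _ = M * A * L ^ (n + 2) / B / N ^ 2 * (B / N ^ n) := by
        rw [div_pow]
        field_simp
        ring
    _ ≤ (M * A * L ^ (n + 2) / B * (2 * (n + 2)) ^ 2 + 1) / (r : ℝ) ^ 2 * (B / N ^ n) := by
        have hr0 : (0 : ℝ) < r := by exact_mod_cast hr
        gcongr ?_ * _
        rw [div_le_div_iff₀ (by positivity) (by positivity)]
        have h₁ : (r : ℝ) ^ 2 ≤ (2 * (n + 2)) ^ 2 * N ^ 2 := by
          rw [← mul_pow]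
          gcongr
        calc M * A * L ^ (n + 2) / B * (r : ℝ) ^ 2
            ≤ M * A * L ^ (n + 2) / B * ((2 * (n + 2)) ^ 2 * N ^ 2) := by gcongr
          _ ≤ _ := by nlinarith [sq_nonneg N]
    _ ≤ _ := by gcongr
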